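/- arXiv:math/0703265 — 3 statements merged into one kernel-verified Lean document; each statement's English description precedes it below -/
import Mathlib

section
/- Let {b_n} be a given sequence of positive reals with b_n → ∞. Then F ∈ L_Δ if and only if there exists a b-insensitivity sequence for F, that is, a sequence {I_n} with I_n ≫ b_n such that sup_{x ≥ I_n} sup_{0 ≤ t ≤ b_n} |F(x−t+Δ)/F(x+Δ) − 1| → 0 as n → ∞. -/
open MeasureTheory Filter Set ProbabilityTheory
open scoped ENNReal NNReal Topology

noncomputable section

/-- Membership in the interval `x + Δ = (x, x+T]`, where `T = ∞` gives `(x, ∞)`. -/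
def memDelta (T : ℝ≥0∞) (x s : ℝ) : Prop :=
  x < s ∧ ENNReal.ofReal (s - x) ≤ T

/-- `F(x + Δ) = P{x < ξ ≤ x + T}` (interpreted as `P{ξ > x}` when `T = ∞`). -/
def Fdel (μ : Measure ℝ) (T : ℝ≥0∞) (x : ℝ) : ℝ :=
  (μ {s | memDelta T x s}).toReal

/-- The right tail `F̄(x) = P{ξ > x}`. -/
def Fbar (μ : Measure ℝ) (x : ℝ) : ℝ := (μ (Set.Ioi x)).toReal

/-- The two-sided tail `Ḡ(x) = P{|ξ| > x}`. -/
def Gbar (μ : Measure ℝ) (x : ℝ) : ℝ := (μ {y : ℝ | x < |y|}).toReal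

/-- Truncated first moment `μ₁(x) = ∫_{|y| ≤ x} y F(dy)`. -/
def mu1 (μ : Measure ℝ) (x : ℝ) : ℝ := ∫ y in {y : ℝ | |y| ≤ x}, y ∂μ

/-- Truncated second moment `μ₂(x) = ∫_{|y| ≤ x} y² F(dy)`. -/
def mu2 (μ : Measure ℝ) (x : ℝ) : ℝ := ∫ y in {y : ℝ | |y| ≤ x}, y ^ 2 ∂μ

/-- `Q(x) = x⁻² μ₂(x) + Ḡ(x)`. -/
def Qfun (μ : Measure ℝ) (x : ℝ) : ℝ := mu2 μ x / x ^ 2 + Gbar μ x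

/-- The random walk `S_n = ξ₁ + ⋯ + ξ_n`. -/
def walk {Ω : Type*} (ξ : ℕ → Ω → ℝ) (n : ℕ) (ω : Ω) : ℝ :=
  ∑ i ∈ Finset.range n, ξ i ω

/-- `{b_n}` is a natural-scale sequence: positive, and `{S_n / b_n}` is tight. -/
def IsNaturalScale {Ω : Type*} [MeasurableSpace Ω] (P : Measure Ω)
    (ξ : ℕ → Ω → ℝ) (b : ℕ → ℝ) : Prop :=
  (∀ n, 0 < b n) ∧
  ∀ ε : ℝ, 0 < ε → ∃ K : ℝ, 0 < K ∧ ∀ n : ℕ,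
    1 - ε ≤ (P {ω | |walk ξ n ω| ≤ K * b n}).toReal

/-- `{I_n}` is a `b`-insensitivity sequence: `I_n ≫ b_n` and
`sup_{x ≥ I_n} sup_{0 ≤ t ≤ b_n} |F(x−t+Δ)/F(x+Δ) − 1| → 0`. -/
def IsInsensitivity (μ : Measure ℝ) (T : ℝ≥0∞) (b I : ℕ → ℝ) : Prop :=
  Tendsto (fun n => b n / I n) atTop (𝓝 0) ∧
  ∀ ε : ℝ, 0 < ε → ∃ N : ℕ, ∀ n ≥ N, ∀ x ≥ I n, ∀ t ∈ Set.Icc (0 : ℝ) (b n),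
    |Fdel μ T (x - t) / Fdel μ T x - 1| ≤ ε

/-- `{h_n}` is a `b`-truncation sequence:
`lim_{K→∞} limsup_{n→∞} sup_{x ≥ h_n} n P{S₂ ∈ x+Δ, ξ₁,ξ₂ ∈ (−∞,−Kb_n) ∪ (h_n,∞)}/F(x+Δ) = 0`. -/
def IsTruncation (μ : Measure ℝ) (T : ℝ≥0∞) (b h : ℕ → ℝ) : Prop :=
  ∀ ε : ℝ, 0 < ε → ∃ K₀ : ℝ, ∀ K ≥ K₀, ∃ N : ℕ, ∀ n ≥ N, ∀ x ≥ h n,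
    (n : ℝ) * ((μ.prod μ) {p : ℝ × ℝ | memDelta T x (p.1 + p.2) ∧
        (p.1 < -(K * b n) ∨ h n < p.1) ∧ (p.2 < -(K * b n) ∨ h n < p.2)}).toReal
      / Fdel μ T x ≤ ε

/-- `{J_n}` is an `h`-small-steps sequence:
`lim_n sup_{x ≥ J_n} sup_{z ≥ x} P{S_n ∈ z+Δ, ξ₁ ≤ h_n, …, ξ_n ≤ h_n}/(n F(x+Δ)) = 0`. -/
def IsSmallSteps {Ω : Type*} [MeasurableSpace Ω] (P : Measure Ω)
    (ξ : ℕ → Ω → ℝ) (μ : Measure ℝ) (T : ℝ≥0∞) (h J : ℕ → ℝ) : Prop :=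
  ∀ ε : ℝ, 0 < ε → ∃ N : ℕ, ∀ n ≥ N, ∀ x ≥ J n, ∀ z ≥ x,
    (P {ω | memDelta T z (walk ξ n ω) ∧ ∀ i < n, ξ i ω ≤ h n}).toReal
      / ((n : ℝ) * Fdel μ T x) ≤ ε

/-- `f` is almost decreasing: `sup_{y ≥ x} f(y) = O(f(x))` as `x → ∞`. -/
def AlmostDecreasing (f : ℝ → ℝ) : Prop :=
  ∃ C : ℝ, 0 < C ∧ ∀ᶠ x in atTop, ∀ y ≥ x, f y ≤ C * f x

/-- `f` is O-regularly varying at infinity: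
`0 < liminf f(xy)/f(x) ≤ limsup f(xy)/f(x) < ∞` for every `y ≥ 1`. -/
def ORegVarying (f : ℝ → ℝ) : Prop :=
  ∀ y : ℝ, 1 ≤ y → ∃ c C : ℝ, 0 < c ∧
    ∀ᶠ x in atTop, c ≤ f (x * y) / f x ∧ f (x * y) / f x ≤ C

/-- `f` is regularly varying at infinity with index `ρ`. -/
def RegVarying (f : ℝ → ℝ) (ρ : ℝ) : Prop :=
  ∀ y : ℝ, 0 < y → Tendsto (fun x => f (x * y) / f x) atTop (𝓝 (y ^ ρ))

/-- `f` is intermediate regularly varying at infinity: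
`lim_{y↓1} liminf_x f(xy)/f(x) = lim_{y↓1} limsup_x f(xy)/f(x) = 1`. -/
def IntermediateRV (f : ℝ → ℝ) : Prop :=
  ∀ ε : ℝ, 0 < ε → ∃ δ : ℝ, 0 < δ ∧ ∀ y ∈ Set.Ioc (1 : ℝ) (1 + δ),
    ∀ᶠ x in atTop, 1 - ε ≤ f (x * y) / f x ∧ f (x * y) / f x ≤ 1 + ε

/-- `f` is long-tailed: `f(x+y) ~ f(x)` as `x → ∞`, for every `y`. -/
def LongTailedFun (f : ℝ → ℝ) : Prop :=
  ∀ y : ℝ, Tendsto (fun x => f (x + y) / f x) atTop (𝓝 1)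

/-- The class `Sd` of subexponential densities. -/
def MemSd (H : ℝ → ℝ) : Prop :=
  (∀ x, 0 ≤ H x) ∧ LongTailedFun H ∧ IntegrableOn H (Set.Ioi 0) ∧
  Tendsto (fun x => (∫ y in (0 : ℝ)..(x / 2), H y * H (x - y)) / H x) atTop
    (𝓝 (∫ y in Set.Ioi (0 : ℝ), H y))

/-- `F ∈ L_Δ`: (locally) long-tailed. -/
def MemLDelta (μ : Measure ℝ) (T : ℝ≥0∞) : Prop :=
  (∀ᶠ x in atTop, 0 < Fdel μ T x) ∧ LongTailedFun (Fdel μ T)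

/-- `F ∈ S_Δ`: (locally) subexponential, i.e. `F ∈ L_Δ` and
`P{S₂ ∈ x+Δ} ~ 2 F(x+Δ)`. -/
def MemSDelta (μ : Measure ℝ) (T : ℝ≥0∞) : Prop :=
  MemLDelta μ T ∧
  Tendsto
    (fun x => ((μ.prod μ) {p : ℝ × ℝ | memDelta T x (p.1 + p.2)}).toReal / Fdel μ T x)
    atTop (𝓝 2)

/-- The exponentially tilted (twisted) step distribution:
`P{ξ^{(n)} ≤ y} = E[e^{ξ/h}; ξ ≤ h, ξ ≤ y] / E[e^{ξ/h}; ξ ≤ h]`. -/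
def tiltMeasure (μ : Measure ℝ) (h : ℝ) : Measure ℝ :=
  (ENNReal.ofReal (∫ x in Set.Iic h, Real.exp (x / h) ∂μ))⁻¹ •
    ((μ.restrict (Set.Iic h)).withDensity fun x => ENNReal.ofReal (Real.exp (x / h)))

/-- The law of `S_n^{(n)} = ξ₁^{(n)} + ⋯ + ξ_n^{(n)}`, a sum of `n` i.i.d. tilted steps. -/
def tiltWalkLaw (μ : Measure ℝ) (h : ℝ) (n : ℕ) : Measure ℝ :=
  (Measure.pi fun _ : Fin n => tiltMeasure μ h).map fun f => ∑ i, f i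

/-- `a` is an upper Matuszewska index of `f`: for every `α > a` there is `C` with
`f(xy)/f(x) ≤ C(1+o(1)) y^α` uniformly in `y ∈ [1, Y]`, for every `Y > 1`. -/
def MatuszewskaUpper (f : ℝ → ℝ) (a : ℝ) : Prop :=
  ∀ α : ℝ, a < α → ∃ C : ℝ, 0 < C ∧ ∀ Y : ℝ, 1 < Y → ∀ δ : ℝ, 0 < δ →
    ∀ᶠ x in atTop, ∀ y ∈ Set.Icc (1 : ℝ) Y, f (x * y) ≤ C * (1 + δ) * y ^ α * f x

/-- `b` is a lower Matuszewska index of `f`: for every `β < b` there is `D > 0` with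
`f(xy)/f(x) ≥ D(1+o(1)) y^β` uniformly in `y ∈ [1, Y]`, for every `Y > 1`. -/
def MatuszewskaLower (f : ℝ → ℝ) (b : ℝ) : Prop :=
  ∀ β : ℝ, β < b → ∃ D : ℝ, 0 < D ∧ ∀ Y : ℝ, 1 < Y → ∀ δ : ℝ, 0 < δ →
    ∀ᶠ x in atTop, ∀ y ∈ Set.Icc (1 : ℝ) Y, D * (1 - δ) * y ^ β * f x ≤ f (x * y)

end

/-- Uniform convergence theorem for additively slowly varying measurable functions. -/
lemma exists_forall_abs_add_sub_le_of_measurable {h : ℝ → ℝ} (hm : Measurable h)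
    (hlim : ∀ y, Tendsto (fun x => h (x + y) - h x) atTop (𝓝 0))
    {A ε : ℝ} (hA : 0 < A) (hε : 0 < ε) :
    ∃ X, ∀ x ≥ X, ∀ u ∈ Set.Icc 0 A, |h (x + u) - h x| ≤ ε := by
  let d : ℝ → ℝ → ℝ := fun a c => min |a - c| 1
  have d_nonneg : ∀ a c, 0 ≤ d a c := fun a c => le_min (abs_nonneg _) zero_le_one
  have d_le : ∀ a c, d a c ≤ 1 := fun a c => min_le_right _ _
  have d_tri : ∀ a c e, d a c ≤ d e c + d e a := by
    intro a c e
    have h1 : |a - c| ≤ |e - c| + |e - a| := by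
      rw [abs_sub_comm e a, add_comm]; exact abs_sub_le a e c
    have h2 := abs_nonneg (e - c)
    have h3 := abs_nonneg (e - a)
    simp only [d]
    grind
  have d_meas : ∀ x c, Measurable fun z => d (h (x + z)) c := by
    intro x c
    have : Measurable fun z => h (x + z) := hm.comp (measurable_const_add x)
    exact ((this.sub_const c).norm).min measurable_const
  have d_int : ∀ x c (s : Set ℝ), volume s ≠ ∞ → IntegrableOn (fun z => d (h (x + z)) c) s := by
    intro x c s hs
    refine Measure.integrableOn_of_bounded (M := 1) hs (d_meas x c).aestronglyMeasurable ?_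
    refine Eventually.of_forall fun z => ?_
    rw [Real.norm_of_nonneg (d_nonneg _ _)]
    exact d_le _ _
  let φ : ℝ → ℝ := fun x => ∫ z in Set.Icc 0 (2 * A), d (h (x + z)) (h x)
  have hφ : Tendsto φ atTop (𝓝 0) := by
    have key : Tendsto φ atTop (𝓝 (∫ _ in Set.Icc 0 (2 * A), (0 : ℝ))) := by
      refine tendsto_integral_filter_of_dominated_convergence (fun _ => (1 : ℝ)) ?_ ?_ ?_ ?_
      · exact Eventually.of_forall fun x => (d_meas x _).aestronglyMeasurable
      · refine Eventually.of_forall fun x => Eventually.of_forall fun z => ?_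
        rw [Real.norm_of_nonneg (d_nonneg _ _)]
        exact d_le _ _
      · exact integrableOn_const measure_Icc_lt_top.ne
      · refine Eventually.of_forall fun z => ?_
        have := ((hlim z).abs).min (tendsto_const_nhds (x := (1 : ℝ)))
        simpa using this
    simpa using key
  have bound : ∀ x, ∀ u ∈ Set.Icc 0 A, A * d (h (x + u)) (h x) ≤ φ x + φ (x + u) := by
    intro x u hu
    have e1 : A * d (h (x + u)) (h x)
        = ∫ _ in Set.Icc A (2 * A), d (h (x + u)) (h x) := by
      rw [setIntegral_const, smul_eq_mul, Real.volume_real_Icc_of_le (by linarith)]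
      ring
    have e2 : ∫ z in Set.Icc A (2 * A), d (h (x + z)) (h x) ≤ φ x :=
      setIntegral_mono_set (d_int _ _ _ measure_Icc_lt_top.ne) (Eventually.of_forall fun z => d_nonneg _ _)
        (Set.Icc_subset_Icc_left hA.le).eventuallyLE
    have e3 : ∫ z in Set.Icc A (2 * A), d (h (x + z)) (h (x + u)) ≤ φ (x + u) := by
      have t := (measurePreserving_sub_right volume u).setIntegral_preimage_emb
        (MeasurableEquiv.subRight u).measurableEmbedding
        (fun w => d (h (x + u + w)) (h (x + u))) (Set.Icc (A - u) (2 * A - u))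
      have hs : (fun w => w - u) ⁻¹' Set.Icc (A - u) (2 * A - u) = Set.Icc A (2 * A) := by
        ext w; simp
      rw [hs] at t
      have hc : ∀ w, x + u + (w - u) = x + w := fun w => by ring
      simp only [hc] at t
      rw [t]
      exact setIntegral_mono_set (d_int _ _ _ measure_Icc_lt_top.ne)
        (Eventually.of_forall fun z => d_nonneg _ _)
        (Set.Icc_subset_Icc (by linarith [hu.2]) (by linarith [hu.1])).eventuallyLE
    calc A * d (h (x + u)) (h x)
        = ∫ _ in Set.Icc A (2 * A), d (h (x + u)) (h x) := e1
      _ ≤ ∫ z in Set.Icc A (2 * A), (d (h (x + z)) (h x) + d (h (x + z)) (h (x + u))) :=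
          integral_mono (integrableOn_const measure_Icc_lt_top.ne)
            ((d_int _ _ _ measure_Icc_lt_top.ne).add (d_int _ _ _ measure_Icc_lt_top.ne)) fun z => d_tri _ _ _
      _ = _ := integral_add (d_int _ _ _ measure_Icc_lt_top.ne) (d_int _ _ _ measure_Icc_lt_top.ne)
      _ ≤ φ x + φ (x + u) := add_le_add e2 e3
  have hδ : 0 < A * min ε 1 / 2 := by positivity
  obtain ⟨X, hX⟩ := eventually_atTop.1 (hφ.eventually (gt_mem_nhds hδ))
  refine ⟨X, fun x hx u hu => ?_⟩
  have h1 := bound x u hu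
  have h2 := hX x hx
  have h3 := hX (x + u) (by linarith [hu.1])
  have h4 : d (h (x + u)) (h x) < min ε 1 := lt_of_mul_lt_mul_left (by linarith) hA.le
  obtain ⟨h5, h6⟩ := lt_min_iff.1 h4
  have h7 := (min_lt_iff.1 h6).resolve_right (lt_irrefl 1)
  exact ((min_eq_left h7.le).symm.trans_lt h5).le

lemma measurable_Fdel (μ : Measure ℝ) [SFinite μ] (T : ℝ≥0∞) : Measurable (Fdel μ T) := by
  have hs : MeasurableSet {p : ℝ × ℝ | memDelta T p.1 p.2} :=
    (measurableSet_lt measurable_fst measurable_snd).inter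
      (measurableSet_le (measurable_snd.sub measurable_fst).ennreal_ofReal measurable_const)
  exact (measurable_measure_prodMk_left hs).ennreal_toReal

/-- The convergence in the definition of a long-tailed function is locally uniform. -/
lemma LongTailedFun.exists_forall_abs_div_sub_one_le {f : ℝ → ℝ} (hf : LongTailedFun f)
    (hm : Measurable f) (hpos : ∀ᶠ x in atTop, 0 < f x) {A ε : ℝ} (hA : 0 < A) (hε : 0 < ε) :
    ∃ X, ∀ x ≥ X, ∀ t ∈ Set.Icc 0 A, |f (x - t) / f x - 1| ≤ ε := by
  have hlim : ∀ y, Tendsto (fun x => Real.log (f (x + y)) - Real.log (f x)) atTop (𝓝 0) := by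
    intro y
    have h1 := (hf y).log one_ne_zero
    rw [Real.log_one] at h1
    refine h1.congr' ?_
    filter_upwards [hpos, (tendsto_atTop_add_const_right atTop y tendsto_id).eventually hpos]
      with x hx hxy
    exact Real.log_div (ne_of_gt hxy) hx.ne'
  obtain ⟨δ, hδ, hexp⟩ := Metric.continuousAt_iff.1 (Real.continuous_exp.continuousAt (x := 0)) ε hε
  obtain ⟨X, hX⟩ := exists_forall_abs_add_sub_le_of_measurable hm.log hlim hA (half_pos hδ)
  obtain ⟨Y, hY⟩ := eventually_atTop.1 hpos
  refine ⟨max X Y + A, fun x hx t ht => ?_⟩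
  have hmax := le_max_left X Y
  have hmax' := le_max_right X Y
  have hx1 : 0 < f x := hY x (by linarith)
  have hx2 : 0 < f (x - t) := hY _ (by linarith [ht.2])
  have h1 := hX (x - t) (by linarith [ht.2]) t ht
  rw [sub_add_cancel, abs_sub_comm] at h1
  have h2 := hexp (x := Real.log (f (x - t)) - Real.log (f x))
    (by rw [Real.dist_eq, sub_zero]; linarith)
  rw [Real.dist_eq, Real.exp_zero, Real.exp_sub, Real.exp_log hx1, Real.exp_log hx2] at h2
  exact h2.le

/-- Lemma 2.2: for a sequence `b_n → ∞` of positive reals, `F ∈ L_Δ` if and only if there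
exists a `b`-insensitivity sequence for `F`. -/
theorem longtailed_iff_insensitivity
    (μ : Measure ℝ) [IsProbabilityMeasure μ] (T : ℝ≥0∞) (hT : 0 < T)
    (b : ℕ → ℝ) (hbpos : ∀ n, 0 < b n) (hb : Tendsto b atTop atTop) :
    MemLDelta μ T ↔ ∃ I : ℕ → ℝ, IsInsensitivity μ T b I := by
  constructor
  · rintro ⟨hpos, hlt⟩
    have hX : ∀ n : ℕ, ∃ X, ∀ x ≥ X, ∀ t ∈ Set.Icc 0 (b n),
        |Fdel μ T (x - t) / Fdel μ T x - 1| ≤ 1 / ((n : ℝ) + 1) := fun n =>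
      hlt.exists_forall_abs_div_sub_one_le (measurable_Fdel μ T) hpos (hbpos n) (by positivity)
    choose X hX using hX
    refine ⟨fun n => max (X n) (((n : ℝ) + 1) * b n), ?_, fun ε hε => ?_⟩
    · refine squeeze_zero (fun n => ?_) (fun n => ?_) tendsto_one_div_add_atTop_nhds_zero_nat
      · have := hbpos n
        have : 0 < max (X n) (((n : ℝ) + 1) * b n) := lt_max_of_lt_right (by positivity)
        positivity
      · have := hbpos n
        calc b n / max (X n) (((n : ℝ) + 1) * b n) ≤ b n / (((n : ℝ) + 1) * b n) := by
              gcongr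
              exact le_max_right _ _
          _ = 1 / ((n : ℝ) + 1) := by field_simp
    · obtain ⟨N, hN⟩ := exists_nat_one_div_lt hε
      refine ⟨N, fun n hn x hx t ht => ?_⟩
      calc _ ≤ 1 / ((n : ℝ) + 1) := hX n x ((le_max_left _ _).trans hx) t ht
        _ ≤ 1 / ((N : ℝ) + 1) := by gcongr
        _ ≤ ε := hN.le
  · rintro ⟨I, -, hI⟩
    have unif : ∀ A ε : ℝ, 0 < ε → ∃ X, ∀ x ≥ X, ∀ t ∈ Set.Icc 0 A,
        |Fdel μ T (x - t) / Fdel μ T x - 1| ≤ ε := by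
      intro A ε hε
      obtain ⟨N, hN⟩ := hI ε hε
      obtain ⟨n, hn, hbn⟩ := ((eventually_ge_atTop N).and (hb.eventually_ge_atTop A)).exists
      exact ⟨I n, fun x hx t ht => hN n hn x hx t ⟨ht.1, ht.2.trans hbn⟩⟩
    have back : ∀ t : ℝ, 0 ≤ t →
        Tendsto (fun x => Fdel μ T (x - t) / Fdel μ T x) atTop (𝓝 1) := by
      intro t ht
      refine Metric.tendsto_atTop.2 fun ε hε => ?_
      obtain ⟨X, hX⟩ := unif t (ε / 2) (half_pos hε)
      refine ⟨X, fun x hx => ?_⟩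
      rw [Real.dist_eq]
      linarith [hX x hx t ⟨ht, le_rfl⟩]
    refine ⟨?_, fun y => ?_⟩
    · obtain ⟨X, hX⟩ := unif 0 (1 / 2) (by norm_num)
      filter_upwards [eventually_ge_atTop X] with x hx
      refine lt_of_le_of_ne ENNReal.toReal_nonneg fun h0 => ?_
      have := hX x hx 0 ⟨le_rfl, le_rfl⟩
      rw [← h0] at this
      norm_num at this
    · rcases le_total 0 y with hy | hy
      · have h1 := ((back y hy).comp
          (tendsto_atTop_add_const_right atTop y tendsto_id)).inv₀ one_ne_zero
        simpa using h1
      · simpa using back (-y) (neg_nonneg.2 hy)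
end

section
/- If x ↦ F(x+Δ) is almost decreasing and O-regularly varying, then any sequence {h_n} with n F̄(h_n) = o(1) satisfies lim_{n→∞} sup_{x ≥ h_n} n P{S₂ ∈ x+Δ, ξ₁ > h_n, ξ₂ > h_n} / F(x+Δ) = 0 (i.e., {h_n} is a truncation sequence for F). -/
open MeasureTheory Filter Set ProbabilityTheory
open scoped ENNReal NNReal Topology

lemma measurableSet_memDelta_add (T : ℝ≥0∞) (x : ℝ) :
    MeasurableSet {p : ℝ × ℝ | memDelta T x (p.1 + p.2)} :=
  (measurableSet_lt measurable_const (measurable_fst.add measurable_snd)).inter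
    (measurableSet_le
      ((measurable_fst.add measurable_snd).sub_const x).ennreal_ofReal measurable_const)

lemma memDelta_mono_right {T : ℝ≥0∞} {x y s t : ℝ} (hs : memDelta T x s) (hy : y < t)
    (hst : t - y ≤ s - x) : memDelta T y t :=
  ⟨hy, (ENNReal.ofReal_le_ofReal hst).trans hs.2⟩

lemma Fdel_le_Fbar (μ : Measure ℝ) [IsProbabilityMeasure μ] (T : ℝ≥0∞) {M x : ℝ} (hx : M ≤ x) :
    Fdel μ T x ≤ Fbar μ M :=
  measureReal_mono (μ := μ) fun _ hs => lt_of_le_of_lt hx hs.1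

/-- An O-regularly varying function that is nonnegative is eventually positive. -/
lemma ORegVarying.eventually_pos {f : ℝ → ℝ} (hf : ORegVarying f) (h0 : ∀ x, 0 ≤ f x) :
    ∀ᶠ x in atTop, 0 < f x := by
  obtain ⟨c, C, hc, hev⟩ := hf 1 le_rfl
  filter_upwards [hev] with x hx
  refine (h0 x).lt_of_ne fun h => ?_
  have h1 := hx.1
  rw [← h, div_zero] at h1
  linarith

/-- If the tail of `μ` never vanishes and `n F̄(h_n) → 0`, then `h_n → ∞`. -/
lemma tendsto_atTop_of_nat_mul_Fbar (μ : Measure ℝ) [IsProbabilityMeasure μ]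
    (hpos : ∀ M, 0 < Fbar μ M) {h : ℕ → ℝ}
    (hh : Tendsto (fun n : ℕ => (n : ℝ) * Fbar μ (h n)) atTop (𝓝 0)) :
    Tendsto h atTop atTop := by
  refine tendsto_atTop.2 fun M => ?_
  filter_upwards [hh.eventually (gt_mem_nhds (hpos M)), eventually_ge_atTop 1] with n hn h1
  by_contra! hlt
  have hle : Fbar μ M ≤ Fbar μ (h n) := measureReal_mono (μ := μ) (Ioi_subset_Ioi hlt.le)
  have h1' : (1 : ℝ) ≤ n := by exact_mod_cast h1
  nlinarith [hpos M]

/-- If `F(z+Δ) ≤ B` for all `z ≥ x/2`, then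
`P{S₂ ∈ x+Δ, h < ξ₁ ≤ x/2} ≤ B F̄(h)`. -/
lemma prod_memDelta_first_le_half (μ : Measure ℝ) [IsProbabilityMeasure μ] (T : ℝ≥0∞)
    {x a B : ℝ} (hB : ∀ z ≥ x / 2, Fdel μ T z ≤ B) :
    (μ.prod μ) {p : ℝ × ℝ | memDelta T x (p.1 + p.2) ∧ a < p.1 ∧ p.1 ≤ x / 2}
      ≤ ENNReal.ofReal B * μ (Ioi a) := by
  have hm : MeasurableSet {p : ℝ × ℝ | memDelta T x (p.1 + p.2) ∧ a < p.1 ∧ p.1 ≤ x / 2} :=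
    (measurableSet_memDelta_add T x).inter
      ((measurableSet_lt measurable_const measurable_fst).inter
        (measurableSet_le measurable_fst measurable_const))
  rw [Measure.prod_apply hm, ← lintegral_indicator_const measurableSet_Ioi]
  refine lintegral_mono fun s => ?_
  by_cases hs : a < s ∧ s ≤ x / 2
  · rw [indicator_of_mem (show s ∈ Ioi a from hs.1)]
    have hle := hB (x - s) (by linarith [hs.2])
    refine (measure_mono fun t ht => ?_).trans
      ((ENNReal.le_ofReal_iff_toReal_le (measure_ne_top μ _) (measureReal_nonneg.trans hle)).2 hle)
    exact memDelta_mono_right ht.1 (by linarith [ht.1.1]) (by linarith)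
  · refine le_of_eq_of_le (measure_mono_null (t := ∅) (fun t ht => hs ht.2) measure_empty) bot_le

/-- If `F(z+Δ) ≤ B` for all `z ≥ x/2`, then
`P{S₂ ∈ x+Δ, ξ₁ > h, ξ₂ > h} ≤ 3 B F̄(h)`. -/
lemma prod_memDelta_both_gt_le (μ : Measure ℝ) [IsProbabilityMeasure μ] (T : ℝ≥0∞)
    {x a B : ℝ} (hB : ∀ z ≥ x / 2, Fdel μ T z ≤ B) :
    ((μ.prod μ) {p : ℝ × ℝ | memDelta T x (p.1 + p.2) ∧ a < p.1 ∧ a < p.2}).toReal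
      ≤ 3 * (B * Fbar μ a) := by
  have hB0 : 0 ≤ B := measureReal_nonneg.trans (hB _ le_rfl)
  have hfst := prod_memDelta_first_le_half μ T (a := a) hB
  have hsnd : (μ.prod μ) {p : ℝ × ℝ | memDelta T x (p.1 + p.2) ∧ a < p.2 ∧ p.2 ≤ x / 2}
      ≤ ENNReal.ofReal B * μ (Ioi a) := by
    rw [← Measure.prod_swap, show (Prod.swap : ℝ × ℝ → ℝ × ℝ) = MeasurableEquiv.prodComm from rfl,
      MeasurableEquiv.map_apply]
    refine le_of_eq_of_le (congrArg _ ?_) hfst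
    ext p
    change memDelta T x (p.2 + p.1) ∧ _ ↔ _
    rw [add_comm]
    rfl
  have hboth : (μ.prod μ) (Ioi a ×ˢ {s | memDelta T (x / 2) s})
      ≤ ENNReal.ofReal B * μ (Ioi a) := by
    rw [Measure.prod_prod, mul_comm]
    gcongr
    exact (ENNReal.le_ofReal_iff_toReal_le (measure_ne_top μ _) hB0).2 (hB _ le_rfl)
  have hcover : {p : ℝ × ℝ | memDelta T x (p.1 + p.2) ∧ a < p.1 ∧ a < p.2} ⊆
      {p : ℝ × ℝ | memDelta T x (p.1 + p.2) ∧ a < p.1 ∧ p.1 ≤ x / 2} ∪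
      {p : ℝ × ℝ | memDelta T x (p.1 + p.2) ∧ a < p.2 ∧ p.2 ≤ x / 2} ∪
      Ioi a ×ˢ {s | memDelta T (x / 2) s} := by
    rintro p ⟨hp, h1, h2⟩
    by_cases h1x : p.1 ≤ x / 2
    · exact Or.inl (Or.inl ⟨hp, h1, h1x⟩)
    by_cases h2x : p.2 ≤ x / 2
    · exact Or.inl (Or.inr ⟨hp, h2, h2x⟩)
    exact Or.inr ⟨h1, memDelta_mono_right hp (not_le.1 h2x) (by linarith)⟩
  have htotal := (measure_mono (μ := μ.prod μ) hcover).trans ((measure_union_le _ _).trans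
    (add_le_add ((measure_union_le _ _).trans (add_le_add hfst hsnd)) hboth))
  refine (ENNReal.toReal_mono (by finiteness) htotal).trans_eq ?_
  rw [ENNReal.toReal_add (by finiteness) (by finiteness),
    ENNReal.toReal_add (by finiteness) (by finiteness), ENNReal.toReal_mul,
    ENNReal.toReal_ofReal hB0, Fbar]
  ring

/-- Lemma 6.1: if `x ↦ F(x+Δ)` is almost decreasing and O-regularly varying, then any
sequence with `n F̄(h_n) = o(1)` is a truncation sequence. -/
theorem truncation_of_O_regular_variation
    (μ : Measure ℝ) [IsProbabilityMeasure μ] (T : ℝ≥0∞) (hT : 0 < T)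
    (hdec : AlmostDecreasing (Fdel μ T)) (hORV : ORegVarying (Fdel μ T))
    (h : ℕ → ℝ) (hh : Tendsto (fun n : ℕ => (n : ℝ) * Fbar μ (h n)) atTop (𝓝 0)) :
    ∀ ε : ℝ, 0 < ε → ∃ N : ℕ, ∀ n ≥ N, ∀ x ≥ h n,
      (n : ℝ) * ((μ.prod μ)
          {p : ℝ × ℝ | memDelta T x (p.1 + p.2) ∧ h n < p.1 ∧ h n < p.2}).toReal
        / Fdel μ T x ≤ ε := by
  intro ε hε
  have h0 : ∀ x, 0 ≤ Fdel μ T x := fun x => measureReal_nonneg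
  have hpos := hORV.eventually_pos h0
  have hbar : ∀ M, 0 < Fbar μ M := fun M => by
    obtain ⟨x, hx, hMx⟩ := (hpos.and (eventually_ge_atTop M)).exists
    exact hx.trans_le (Fdel_le_Fbar μ T hMx)
  have htop := tendsto_atTop_of_nat_mul_Fbar μ hbar hh
  obtain ⟨C, hC, hdecC⟩ := hdec
  obtain ⟨c, _, hc, hratio⟩ := hORV 2 one_le_two
  obtain ⟨X, hX⟩ := eventually_atTop.1 (hpos.and (hdecC.and hratio))
  have hδ : 0 < ε * c / (3 * C) := by positivity
  refine eventually_atTop.1 ?_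
  filter_upwards [hh.eventually (gt_mem_nhds hδ), htop.eventually_ge_atTop (max X (2 * X))]
    with n hn hhn x hx
  have hxX : X ≤ x := (le_max_left _ _).trans (hhn.trans hx)
  have hx2X : X ≤ x / 2 := by linarith [(le_max_right X (2 * X)).trans (hhn.trans hx)]
  obtain ⟨hhalf, hmono, hcx, -⟩ := hX _ hx2X
  have hgx := (hX _ hxX).1
  rw [div_mul_cancel₀ x two_ne_zero, le_div_iff₀ hhalf] at hcx
  rw [div_le_iff₀ hgx]
  rw [lt_div_iff₀ (by positivity)] at hn
  calc _ ≤ (n : ℝ) * (3 * (C * Fdel μ T (x / 2) * Fbar μ (h n))) := by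
        gcongr
        exact prod_memDelta_both_gt_le μ T hmono
    _ = (n * Fbar μ (h n) * (3 * C)) * Fdel μ T (x / 2) := by ring
    _ ≤ ε * c * Fdel μ T (x / 2) := by gcongr
    _ = ε * (c * Fdel μ T (x / 2)) := by ring
    _ ≤ ε * Fdel μ T x := by gcongr
end

section
/- Let T < ∞ and h_n → ∞, and suppose that either (1) E{ξ²} < ∞ and E{ξ} = 0, or (2) E{ξ²} = ∞ and limsup_{x→∞} x² Ḡ(x)/μ₂(x) < ∞. Then there exist finite constants C, C' such that, for all sufficiently large n, sup_{x ∈ ℝ} P{S_n^{(n)} ∈ (x, x+T]} ≤ C/h_n + C'/a_n, where a_n solves Q(a_n) = 1/n. -/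
open MeasureTheory Filter Set ProbabilityTheory
open scoped ENNReal NNReal Topology

theorem sq_norm_charFun_eq_integral_cos (lam : Measure ℝ) [IsFiniteMeasure lam] (u : ℝ) :
    ‖charFun lam u‖ ^ 2 = ∫ p : ℝ × ℝ, Real.cos ((p.1 - p.2) * u) ∂(lam.prod lam) := by
  have h1 : charFun lam u * charFun lam (-u) =
      ∫ p : ℝ × ℝ, Complex.exp ((((p.1 - p.2) * u : ℝ) : ℂ) * Complex.I) ∂(lam.prod lam) := by
    rw [charFun_apply_real, charFun_apply_real, ← integral_prod_mul]
    refine integral_congr_ae (Eventually.of_forall fun p => ?_)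
    simp only
    rw [← Complex.exp_add]
    congr 1
    push_cast
    ring
  have hint : Integrable
      (fun p : ℝ × ℝ => Complex.exp ((((p.1 - p.2) * u : ℝ) : ℂ) * Complex.I)) (lam.prod lam) := by
    refine Integrable.of_bound (C := 1) (by fun_prop) (Eventually.of_forall fun p => ?_)
    rw [Complex.norm_exp_ofReal_mul_I]
  have h2 := congrArg Complex.re h1
  rw [charFun_neg, Complex.mul_conj, Complex.ofReal_re, Complex.normSq_eq_norm_sq] at h2
  rw [h2]
  have h3 := integral_re (𝕜 := ℂ) hint
  simp only [RCLike.re_to_complex, Complex.exp_ofReal_mul_I_re] at h3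
  exact h3.symm

theorem integral_cos_mul_sub_le_norm_charFun (ρ : Measure ℝ) [IsFiniteMeasure ρ] (v x : ℝ) :
    ∫ s, Real.cos (v * (s - x)) ∂ρ ≤ ‖charFun ρ v‖ := by
  have hint : Integrable
      (fun s : ℝ => Complex.exp (((v * (s - x) : ℝ) : ℂ) * Complex.I)) ρ := by
    refine Integrable.of_bound (C := 1) (by fun_prop) (Eventually.of_forall fun p => ?_)
    rw [Complex.norm_exp_ofReal_mul_I]
  have h3 := integral_re (𝕜 := ℂ) hint
  simp only [RCLike.re_to_complex, Complex.exp_ofReal_mul_I_re] at h3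
  rw [h3]
  have h4 : ∫ s, Complex.exp (((v * (s - x) : ℝ) : ℂ) * Complex.I) ∂ρ =
      Complex.exp (((-(v * x) : ℝ) : ℂ) * Complex.I) * charFun ρ v := by
    rw [charFun_apply_real, ← integral_const_mul]
    refine integral_congr_ae (Eventually.of_forall fun p => ?_)
    simp only
    rw [← Complex.exp_add]
    congr 1
    push_cast
    ring
  rw [h4]
  refine (Complex.re_le_norm _).trans ?_
  rw [norm_mul, Complex.norm_exp_ofReal_mul_I, one_mul]

theorem mul_cos_one_le_norm_charFun_Ioc {η : ℝ} (hη : 0 < η) {u : ℝ} (hu : |u| ≤ 1 / η) :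
    η * Real.cos 1 ≤ ‖charFun (volume.restrict (Ioc 0 η)) u‖ := by
  refine le_trans ?_ (integral_cos_mul_sub_le_norm_charFun _ u 0)
  have : η * Real.cos 1 = ∫ _s in Ioc 0 η, Real.cos 1 := by
    simp [hη.le]
  rw [this]
  refine setIntegral_mono_on (integrable_const _) ?_ measurableSet_Ioc fun s hs => ?_
  · refine Integrable.of_bound (C := 1) (by fun_prop) (Eventually.of_forall fun p => ?_)
    exact Real.abs_cos_le_one _
  · rw [sub_zero, ← Real.cos_abs (u * s)]
    have h1 : |u * s| ≤ 1 := by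
      rw [abs_mul, abs_of_pos hs.1]
      calc |u| * s ≤ 1 / η * η := mul_le_mul hu hs.2 hs.1.le (by positivity)
        _ = 1 := by field_simp
    exact Real.cos_le_cos_of_nonneg_of_le_pi (abs_nonneg _) (by linarith [Real.pi_gt_three]) h1

/-- Esseen's concentration inequality. -/
theorem measureReal_closedBall_le_integral_of_norm_charFun_le (ρ : Measure ℝ)
    [IsProbabilityMeasure ρ] {η : ℝ} (hη : 0 < η) {g : ℝ → ℝ} (hg : Integrable g)
    (hg0 : ∀ t, 0 ≤ g t) (hφ : ∀ t, |t| ≤ η → ‖charFun ρ t‖ ≤ g t) (x : ℝ) :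
    ρ.real (Metric.closedBall x (1 / η)) * (η * Real.cos 1 ^ 2) ≤ ∫ t, g t := by
  set lam : Measure ℝ := volume.restrict (Ioc 0 η) with hlam
  have hcos : 0 < Real.cos 1 := Real.cos_one_pos
  have hF : Integrable (fun q : ℝ × (ℝ × ℝ) => Real.cos ((q.2.1 - q.2.2) * (q.1 - x)))
      (ρ.prod (lam.prod lam)) := by
    refine Integrable.of_bound (C := 1) (by fun_prop) (Eventually.of_forall fun p => ?_)
    exact Real.abs_cos_le_one _
  have hK : Integrable (fun s => ‖charFun lam (s - x)‖ ^ 2) ρ := by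
    simp only [sq_norm_charFun_eq_integral_cos]
    exact hF.integral_prod_left
  have hlow : ρ.real (Metric.closedBall x (1 / η)) * (η * Real.cos 1) ^ 2 ≤
      ∫ s, ‖charFun lam (s - x)‖ ^ 2 ∂ρ := by
    calc ρ.real (Metric.closedBall x (1 / η)) * (η * Real.cos 1) ^ 2
        = ∫ _s in Metric.closedBall x (1 / η), (η * Real.cos 1) ^ 2 ∂ρ := by simp
      _ ≤ ∫ s in Metric.closedBall x (1 / η), ‖charFun lam (s - x)‖ ^ 2 ∂ρ := by
          refine setIntegral_mono_on (integrable_const _) hK.integrableOn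
            Metric.isClosed_closedBall.measurableSet fun s hs => ?_
          have hs' : |s - x| ≤ 1 / η := by simpa [Real.dist_eq] using hs
          exact pow_le_pow_left₀ (by positivity) (mul_cos_one_le_norm_charFun_Ioc hη hs') 2
      _ ≤ ∫ s, ‖charFun lam (s - x)‖ ^ 2 ∂ρ :=
          setIntegral_le_integral hK (Eventually.of_forall fun s => by positivity)
  have hnorm : Integrable (fun p : ℝ × ℝ => ‖charFun ρ (p.1 - p.2)‖) (lam.prod lam) := by
    have hc : Continuous (charFun ρ) := continuous_charFun
    refine Integrable.of_bound (C := 1) (by fun_prop) (Eventually.of_forall fun p => ?_)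
    simpa using norm_charFun_le_one (μ := ρ) (p.1 - p.2)
  have hup : ∫ s, ‖charFun lam (s - x)‖ ^ 2 ∂ρ ≤ η * ∫ t, g t := by
    calc ∫ s, ‖charFun lam (s - x)‖ ^ 2 ∂ρ
        = ∫ s, ∫ p : ℝ × ℝ, Real.cos ((p.1 - p.2) * (s - x)) ∂(lam.prod lam) ∂ρ := by
          simp only [sq_norm_charFun_eq_integral_cos]
      _ = ∫ p : ℝ × ℝ, ∫ s, Real.cos ((p.1 - p.2) * (s - x)) ∂ρ ∂(lam.prod lam) :=
          integral_integral_swap hF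
      _ ≤ ∫ p : ℝ × ℝ, ‖charFun ρ (p.1 - p.2)‖ ∂(lam.prod lam) :=
          integral_mono hF.integral_prod_right hnorm
            fun p => integral_cos_mul_sub_le_norm_charFun ρ _ x
      _ = ∫ σ, ∫ τ, ‖charFun ρ (σ - τ)‖ ∂lam ∂lam := integral_prod _ hnorm
      _ ≤ ∫ _σ, (∫ t, g t) ∂lam := by
          refine setIntegral_mono_on hnorm.integral_prod_left (integrable_const _)
            measurableSet_Ioc fun σ hσ => ?_
          have hgi : Integrable fun τ => g (σ - τ) := hg.comp_sub_left σ
          calc ∫ τ, ‖charFun ρ (σ - τ)‖ ∂lam ≤ ∫ τ in Ioc 0 η, g (σ - τ) := by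
                refine setIntegral_mono_on ?_ hgi.integrableOn measurableSet_Ioc fun τ hτ => ?_
                · have hc : Continuous (charFun ρ) := continuous_charFun
                  refine Integrable.of_bound (C := 1) (by fun_prop)
                    (Eventually.of_forall fun p => ?_)
                  simpa using norm_charFun_le_one (μ := ρ) (σ - p)
                · refine hφ _ (abs_le.2 ⟨?_, ?_⟩) <;> linarith [hσ.1, hσ.2, hτ.1, hτ.2]
            _ ≤ ∫ τ, g (σ - τ) :=
                setIntegral_le_integral hgi (Eventually.of_forall fun τ => hg0 _)
            _ = ∫ t, g t := integral_sub_left_eq_self g volume σ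
      _ = η * ∫ t, g t := by simp [lam, hη.le]
  have h := hlow.trans hup
  refine le_of_mul_le_mul_left ?_ hη
  calc η * (ρ.real (Metric.closedBall x (1 / η)) * (η * Real.cos 1 ^ 2))
      = ρ.real (Metric.closedBall x (1 / η)) * (η * Real.cos 1) ^ 2 := by ring
    _ ≤ _ := h

/-- The mass of `[-L, L]` times the second moment on it, minus the squared first moment on it. -/
noncomputable def truncVar (μ : Measure ℝ) (L : ℝ) : ℝ :=
  mu2 μ L * μ.real {y : ℝ | |y| ≤ L} - mu1 μ L ^ 2

theorem measurableSet_abs_le (L : ℝ) : MeasurableSet {y : ℝ | |y| ≤ L} :=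
  measurableSet_le measurable_abs measurable_const

theorem smul_restrict_le_tiltMeasure (μ : Measure ℝ) [IsProbabilityMeasure μ] {h L : ℝ}
    (hh : 0 < h) (hL : L ≤ h) :
    ENNReal.ofReal (Real.exp (-2)) • μ.restrict {y : ℝ | |y| ≤ L} ≤ tiltMeasure μ h := by
  have hm : ∫ x in Set.Iic h, Real.exp (x / h) ∂μ ≤ Real.exp 1 := by
    have h1 : ‖∫ x in Set.Iic h, Real.exp (x / h) ∂μ‖ ≤ Real.exp 1 * μ.real (Set.Iic h) := by
      refine norm_setIntegral_le_of_norm_le_const (measure_lt_top _ _) fun x hx => ?_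
      rw [Real.norm_of_nonneg (Real.exp_pos _).le]
      exact Real.exp_le_exp.2 ((div_le_one hh).2 hx)
    calc _ ≤ _ := Real.le_norm_self _
      _ ≤ _ := h1
      _ ≤ Real.exp 1 * 1 := by gcongr; exact measureReal_le_one
      _ = _ := mul_one _
  have hm' : ENNReal.ofReal (Real.exp (-1)) ≤
      (ENNReal.ofReal (∫ x in Set.Iic h, Real.exp (x / h) ∂μ))⁻¹ := by
    rw [Real.exp_neg, ENNReal.ofReal_inv_of_pos (Real.exp_pos _)]
    exact ENNReal.inv_le_inv.2 (ENNReal.ofReal_le_ofReal hm)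
  refine Measure.le_iff.2 fun s hs => ?_
  rw [tiltMeasure, Measure.smul_apply, Measure.smul_apply, smul_eq_mul, smul_eq_mul,
    withDensity_apply _ hs]
  have hexp : ENNReal.ofReal (Real.exp (-2)) =
      ENNReal.ofReal (Real.exp (-1)) * ENNReal.ofReal (Real.exp (-1)) := by
    rw [← ENNReal.ofReal_mul (Real.exp_pos _).le, ← Real.exp_add]; norm_num
  rw [hexp, mul_assoc]
  refine mul_le_mul' hm' ?_
  have hmB := measurableSet_abs_le L
  calc ENNReal.ofReal (Real.exp (-1)) * μ.restrict {y : ℝ | |y| ≤ L} s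
      = ∫⁻ _x in s, ENNReal.ofReal (Real.exp (-1)) ∂(μ.restrict {y : ℝ | |y| ≤ L}) := by simp
    _ ≤ ∫⁻ x in s, ENNReal.ofReal (Real.exp (x / h)) ∂(μ.restrict {y : ℝ | |y| ≤ L}) := by
        refine setLIntegral_mono_ae (by fun_prop) ?_
        filter_upwards [ae_restrict_mem hmB] with x hx _
        refine ENNReal.ofReal_le_ofReal (Real.exp_le_exp.2 ?_)
        rw [le_div_iff₀ hh]
        have := (abs_le.1 (show |x| ≤ L from hx)).1
        linarith
    _ ≤ ∫⁻ x in s, ENNReal.ofReal (Real.exp (x / h)) ∂(μ.restrict (Set.Iic h)) := by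
        refine lintegral_mono' (Measure.restrict_mono le_rfl
          (Measure.restrict_mono (fun x hx => ?_) le_rfl)) le_rfl
        exact ((le_abs_self x).trans hx).trans hL

theorem isProbabilityMeasure_tiltMeasure (μ : Measure ℝ) [IsProbabilityMeasure μ] {h : ℝ}
    (hh : 0 < h) (hμ : μ (Set.Iic h) ≠ 0) : IsProbabilityMeasure (tiltMeasure μ h) := by
  have hint : Integrable (fun x => Real.exp (x / h)) (μ.restrict (Set.Iic h)) := by
    refine Integrable.of_bound (C := Real.exp 1) (by fun_prop) ?_
    filter_upwards [ae_restrict_mem measurableSet_Iic] with x hx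
    rw [Real.norm_of_nonneg (Real.exp_pos _).le]
    exact Real.exp_le_exp.2 ((div_le_one hh).2 hx)
  have hpos : 0 < ∫ x in Set.Iic h, Real.exp (x / h) ∂μ := by
    have : NeZero (μ.restrict (Set.Iic h)) := ⟨fun h0 => hμ (Measure.restrict_eq_zero.1 h0)⟩
    exact integral_exp_pos hint
  constructor
  rw [tiltMeasure, Measure.smul_apply, smul_eq_mul, withDensity_apply _ MeasurableSet.univ,
    Measure.restrict_univ,
    ← ofReal_integral_eq_lintegral_ofReal hint (Eventually.of_forall fun x => (Real.exp_pos _).le)]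
  exact ENNReal.inv_mul_cancel (by simpa using hpos) ENNReal.ofReal_ne_top

theorem integral_prod_sub_sq {κ : Measure ℝ} [IsFiniteMeasure κ] (h1 : Integrable (fun y => y) κ)
    (h2 : Integrable (fun y => y ^ 2) κ) :
    Integrable (fun p : ℝ × ℝ => (p.1 - p.2) ^ 2) (κ.prod κ) ∧
    ∫ p : ℝ × ℝ, (p.1 - p.2) ^ 2 ∂(κ.prod κ) =
      2 * ((∫ y, y ^ 2 ∂κ) * κ.real univ - (∫ y, y ∂κ) ^ 2) := by
  have i1 : Integrable (fun p : ℝ × ℝ => p.1 ^ 2 * 1) (κ.prod κ) :=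
    h2.mul_prod (integrable_const 1)
  have i2 : Integrable (fun p : ℝ × ℝ => 1 * p.2 ^ 2) (κ.prod κ) :=
    (integrable_const 1).mul_prod h2
  have i3 : Integrable (fun p : ℝ × ℝ => p.1 * p.2) (κ.prod κ) := h1.mul_prod h1
  have e : (fun p : ℝ × ℝ => (p.1 - p.2) ^ 2) =
      fun p => (p.1 ^ 2 * 1 + 1 * p.2 ^ 2) - 2 * (p.1 * p.2) := by
    ext p; ring
  rw [e]
  refine ⟨(i1.add i2).sub (i3.const_mul 2), ?_⟩
  have i12 : Integrable (fun p : ℝ × ℝ => p.1 ^ 2 * 1 + 1 * p.2 ^ 2) (κ.prod κ) := i1.add i2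
  rw [integral_sub i12 (i3.const_mul 2), integral_add i1 i2, integral_const_mul 2,
    integral_prod_mul (fun y : ℝ => y ^ 2) (fun _ : ℝ => (1 : ℝ)),
    integral_prod_mul (fun _ : ℝ => (1 : ℝ)) (fun y : ℝ => y ^ 2),
    integral_prod_mul (fun y : ℝ => y) (fun y : ℝ => y)]
  simp
  ring

theorem sq_norm_charFun_tiltMeasure_le (μ : Measure ℝ) [IsProbabilityMeasure μ] {h L t : ℝ}
    [IsProbabilityMeasure (tiltMeasure μ h)] (hL : 0 < L) (hLh : L ≤ h) (ht : |t| = 1 / L) :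
    ‖charFun (tiltMeasure μ h) t‖ ^ 2 ≤
      1 - 4 / Real.pi ^ 2 * Real.exp (-2) ^ 2 * (truncVar μ L / L ^ 2) := by
  set ν := tiltMeasure μ h
  set κ : Measure ℝ := ENNReal.ofReal (Real.exp (-2)) • μ.restrict {y : ℝ | |y| ≤ L} with hκ
  have hle : κ ≤ ν := smul_restrict_le_tiltMeasure μ (hL.trans_le hLh) hLh
  have : IsFiniteMeasure κ := isFiniteMeasure_of_le ν hle
  have hmB := measurableSet_abs_le L
  have hae : ∀ᵐ y ∂κ, |y| ≤ L := Measure.ae_smul_measure (ae_restrict_mem hmB) _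
  have h1 : Integrable (fun y => y) κ := Integrable.of_bound (C := L) (by fun_prop) hae
  have h2 : Integrable (fun y => y ^ 2) κ := by
    refine Integrable.of_bound (C := L ^ 2) (by fun_prop) ?_
    filter_upwards [hae] with y hy
    rw [norm_pow]
    exact pow_le_pow_left₀ (norm_nonneg _) hy 2
  obtain ⟨hi, he⟩ := integral_prod_sub_sq h1 h2
  have hcosint (m : Measure (ℝ × ℝ)) [IsFiniteMeasure m] :
      Integrable (fun p : ℝ × ℝ => Real.cos ((p.1 - p.2) * t)) m :=
    Integrable.of_bound (C := 1) (by fun_prop)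
      (Eventually.of_forall fun p => Real.abs_cos_le_one _)
  have hvar : (∫ y, y ^ 2 ∂κ) * κ.real univ - (∫ y, y ∂κ) ^ 2 =
      Real.exp (-2) ^ 2 * truncVar μ L := by
    rw [hκ, integral_smul_measure, integral_smul_measure, measureReal_ennreal_smul_apply,
      ENNReal.toReal_ofReal (Real.exp_pos _).le, truncVar, mu1, mu2, smul_eq_mul, smul_eq_mul,
      measureReal_restrict_apply_univ]
    ring
  have ht2 : t ^ 2 = 1 / L ^ 2 := by rw [← sq_abs, ht, div_pow, one_pow]
  have key : 4 / Real.pi ^ 2 * Real.exp (-2) ^ 2 * (truncVar μ L / L ^ 2) ≤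
      ∫ p : ℝ × ℝ, (1 - Real.cos ((p.1 - p.2) * t)) ∂(ν.prod ν) := by
    calc 4 / Real.pi ^ 2 * Real.exp (-2) ^ 2 * (truncVar μ L / L ^ 2)
        = 2 / Real.pi ^ 2 * t ^ 2 * ∫ p : ℝ × ℝ, (p.1 - p.2) ^ 2 ∂(κ.prod κ) := by
          rw [he, hvar, ht2]; ring
      _ = ∫ p : ℝ × ℝ, 2 / Real.pi ^ 2 * t ^ 2 * (p.1 - p.2) ^ 2 ∂(κ.prod κ) :=
          (integral_const_mul _ _).symm
      _ ≤ ∫ p : ℝ × ℝ, (1 - Real.cos ((p.1 - p.2) * t)) ∂(κ.prod κ) := by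
          refine integral_mono_ae (hi.const_mul _) ((integrable_const 1).sub (hcosint _)) ?_
          filter_upwards [Measure.quasiMeasurePreserving_fst.ae hae,
            Measure.quasiMeasurePreserving_snd.ae hae] with p hp1 hp2
          have hb : |(p.1 - p.2) * t| ≤ Real.pi := by
            rw [abs_mul, ht]
            calc |p.1 - p.2| * (1 / L) ≤ (L + L) * (1 / L) := by
                  gcongr
                  exact (abs_sub _ _).trans (add_le_add hp1 hp2)
              _ = 2 := by field_simp; norm_num
              _ ≤ Real.pi := by linarith [Real.pi_gt_three]
          have := Real.cos_le_one_sub_mul_cos_sq hb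
          nlinarith
      _ ≤ ∫ p : ℝ × ℝ, (1 - Real.cos ((p.1 - p.2) * t)) ∂(ν.prod ν) := by
          refine integral_mono_measure (Measure.prod_mono hle hle)
            (Eventually.of_forall fun p => ?_) ((integrable_const 1).sub (hcosint _))
          simpa using Real.cos_le_one _
  rw [integral_sub (integrable_const 1) (hcosint _), ← sq_norm_charFun_eq_integral_cos] at key
  simp only [integral_const, probReal_univ, smul_eq_mul, mul_one] at key
  linarith

theorem integrableOn_sq_abs_le (μ : Measure ℝ) [IsFiniteMeasure μ] (L : ℝ) :
    IntegrableOn (fun y : ℝ => y ^ 2) {y : ℝ | |y| ≤ L} μ := by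
  refine Integrable.of_bound (C := L ^ 2) (by fun_prop) ?_
  filter_upwards [ae_restrict_mem (measurableSet_abs_le L)] with y hy
  rw [norm_pow]
  exact pow_le_pow_left₀ (norm_nonneg _) hy 2

theorem compl_setOf_abs_le (L : ℝ) : {y : ℝ | |y| ≤ L}ᶜ = {y : ℝ | L < |y|} := by
  ext y; simp

theorem integrable_min_sq_div (μ : Measure ℝ) [IsFiniteMeasure μ] (x : ℝ) :
    Integrable (fun y : ℝ => min (y ^ 2 / x ^ 2) 1) μ := by
  refine Integrable.of_bound (C := 1) (by fun_prop) (Eventually.of_forall fun y => ?_)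
  rw [Real.norm_of_nonneg (le_min (by positivity) zero_le_one)]
  exact min_le_right _ _

theorem Qfun_eq_integral_min (μ : Measure ℝ) [IsFiniteMeasure μ] {x : ℝ} (hx : 0 < x) :
    Qfun μ x = ∫ y, min (y ^ 2 / x ^ 2) 1 ∂μ := by
  have hmB := measurableSet_abs_le x
  rw [← integral_add_compl hmB (integrable_min_sq_div μ x), Qfun, mu2, Gbar]
  congr 1
  · rw [← integral_div]
    refine setIntegral_congr_fun hmB fun y hy => ?_
    have hy' : y ^ 2 ≤ x ^ 2 := sq_le_sq.2 (by rwa [abs_of_pos hx])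
    exact (min_eq_left ((div_le_one (by positivity)).2 hy')).symm
  · have : ∫ y in {y : ℝ | |y| ≤ x}ᶜ, min (y ^ 2 / x ^ 2) 1 ∂μ =
        ∫ _y in {y : ℝ | |y| ≤ x}ᶜ, (1 : ℝ) ∂μ := by
      refine setIntegral_congr_fun hmB.compl fun y hy => ?_
      rw [compl_setOf_abs_le] at hy
      have hy' : x ^ 2 ≤ y ^ 2 := sq_le_sq.2 (by rw [abs_of_pos hx]; exact le_of_lt hy)
      exact min_eq_right ((one_le_div (by positivity)).2 hy')
    rw [this, compl_setOf_abs_le]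
    simp [Measure.real]

theorem Qfun_le_Qfun (μ : Measure ℝ) [IsFiniteMeasure μ] {x z : ℝ} (hx : 0 < x) (hxz : x ≤ z) :
    Qfun μ z ≤ Qfun μ x := by
  rw [Qfun_eq_integral_min μ hx, Qfun_eq_integral_min μ (hx.trans_le hxz)]
  refine integral_mono (integrable_min_sq_div μ z) (integrable_min_sq_div μ x) fun y => ?_
  dsimp only
  gcongr

theorem Qfun_two_mul_le (μ : Measure ℝ) [IsFiniteMeasure μ] {x : ℝ} (hx : 0 < x) :
    Qfun μ (2 * x) ≤ Qfun μ x / 4 + 3 / 4 * Gbar μ x := by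
  have hms : MeasurableSet {y : ℝ | x < |y|} := by
    rw [← compl_setOf_abs_le]; exact (measurableSet_abs_le x).compl
  have hind : Integrable ({y : ℝ | x < |y|}.indicator fun _ => (3 / 4 : ℝ)) μ :=
    (integrable_const _).indicator hms
  have hG : 3 / 4 * Gbar μ x = ∫ y, {y : ℝ | x < |y|}.indicator (fun _ => (3 / 4 : ℝ)) y ∂μ := by
    rw [integral_indicator hms]
    simp [Gbar, Measure.real, mul_comm]
  rw [Qfun_eq_integral_min μ hx, Qfun_eq_integral_min μ (by positivity), hG, ← integral_div,
    ← integral_add ((integrable_min_sq_div μ x).div_const 4) hind]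
  refine integral_mono (integrable_min_sq_div μ _)
    (((integrable_min_sq_div μ x).div_const 4).add hind) fun y => ?_
  by_cases hy : x < |y|
  · have hy' : x ^ 2 ≤ y ^ 2 := sq_le_sq.2 (by rw [abs_of_pos hx]; exact hy.le)
    have h1 : min (y ^ 2 / x ^ 2) 1 = 1 := min_eq_right ((one_le_div (by positivity)).2 hy')
    have h2 : {y : ℝ | x < |y|}.indicator (fun _ => (3 / 4 : ℝ)) y = 3 / 4 :=
      Set.indicator_of_mem (show y ∈ {y : ℝ | x < |y|} from hy) _
    simp only [h1, h2]
    exact (min_le_right _ _).trans (by norm_num)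
  · have hy' : y ^ 2 ≤ x ^ 2 := sq_le_sq.2 (by rw [abs_of_pos hx]; exact not_lt.1 hy)
    have h1 : min (y ^ 2 / x ^ 2) 1 = y ^ 2 / x ^ 2 :=
      min_eq_left ((div_le_one (by positivity)).2 hy')
    have h2 : {y : ℝ | x < |y|}.indicator (fun _ => (3 / 4 : ℝ)) y = 0 :=
      Set.indicator_of_notMem (show y ∉ {y : ℝ | x < |y|} from hy) _
    simp only [h1, h2]
    refine (min_le_left _ _).trans (le_of_eq ?_)
    field_simp
    ring

theorem mul_pow_Qfun_le (μ : Measure ℝ) [IsFiniteMeasure μ] {x₀ C : ℝ} (hx₀ : 0 < x₀) (hC : 0 < C)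
    (hG : ∀ x ≥ x₀, x ^ 2 * Gbar μ x ≤ C * mu2 μ x) (k : ℕ) :
    ∀ x ≥ x₀, ((4 + 4 * C) / (1 + 4 * C)) ^ k * Qfun μ (2 ^ k * x) ≤ Qfun μ x := by
  induction k with
  | zero => intro x _; simp
  | succ k ih =>
    intro x hx
    have hx' : 0 < x := hx₀.trans_le hx
    have h1 := ih (2 * x) (by linarith)
    have h2 := Qfun_two_mul_le μ hx'
    have h3 : Gbar μ x ≤ C * (mu2 μ x / x ^ 2) := by
      rw [← mul_div_assoc, le_div_iff₀ (by positivity), mul_comm]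
      exact hG x hx
    have h4 : (1 + C) * Gbar μ x ≤ C * Qfun μ x := by
      rw [Qfun]; linarith
    have h5 : (4 + 4 * C) / (1 + 4 * C) * Qfun μ (2 * x) ≤ Qfun μ x := by
      rw [div_mul_eq_mul_div, div_le_iff₀ (by positivity)]
      nlinarith
    calc ((4 + 4 * C) / (1 + 4 * C)) ^ (k + 1) * Qfun μ (2 ^ (k + 1) * x)
        = (4 + 4 * C) / (1 + 4 * C) *
          (((4 + 4 * C) / (1 + 4 * C)) ^ k * Qfun μ (2 ^ k * (2 * x))) := by
          rw [show (2 : ℝ) ^ (k + 1) * x = 2 ^ k * (2 * x) by ring]; ring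
      _ ≤ (4 + 4 * C) / (1 + 4 * C) * Qfun μ (2 * x) := by gcongr
      _ ≤ Qfun μ x := h5

theorem aecover_abs_le (μ : Measure ℝ) : AECover μ atTop fun L : ℝ => {y : ℝ | |y| ≤ L} where
  ae_eventually_mem := Eventually.of_forall fun y => eventually_ge_atTop |y|
  measurableSet := measurableSet_abs_le

theorem tendsto_measureReal_abs_le (μ : Measure ℝ) [IsProbabilityMeasure μ] :
    Tendsto (fun L : ℝ => μ.real {y : ℝ | |y| ≤ L}) atTop (𝓝 1) := by
  simpa using (aecover_abs_le μ).integral_tendsto_of_countably_generated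
    (integrable_const (1 : ℝ))

theorem eventually_moment_bounds_of_integrable_sq (μ : Measure ℝ) [IsProbabilityMeasure μ]
    (hi : Integrable (fun y : ℝ => y ^ 2) μ) (h0 : ∫ y, y ∂μ = 0)
    (hQ : ∃ x > 0, 0 < Qfun μ x) :
    ∀ᶠ L in atTop, mu2 μ L ≤ 2 * truncVar μ L ∧ L ^ 2 * Gbar μ L ≤ mu2 μ L := by
  have hi1 : Integrable (fun y : ℝ => y) μ :=
    ((memLp_two_iff_integrable_sq (by fun_prop)).2 hi).integrable (by norm_num)
  have t2 : Tendsto (mu2 μ) atTop (𝓝 (∫ y, y ^ 2 ∂μ)) :=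
    (aecover_abs_le μ).integral_tendsto_of_countably_generated hi
  have t1 : Tendsto (mu1 μ) atTop (𝓝 0) := by
    rw [← h0]
    exact (aecover_abs_le μ).integral_tendsto_of_countably_generated hi1
  have tV : Tendsto (truncVar μ) atTop (𝓝 (∫ y, y ^ 2 ∂μ)) := by
    have := (t2.mul (tendsto_measureReal_abs_le μ)).sub (t1.pow 2)
    rwa [mul_one, zero_pow two_ne_zero, sub_zero] at this
  have hpos : 0 < ∫ y, y ^ 2 ∂μ := by
    obtain ⟨x, hx, hQx⟩ := hQ
    rw [Qfun_eq_integral_min μ hx] at hQx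
    have h1 : ∫ y, min (y ^ 2 / x ^ 2) 1 ∂μ ≤ ∫ y, y ^ 2 / x ^ 2 ∂μ :=
      integral_mono (integrable_min_sq_div μ x) (hi.div_const _) fun y => min_le_left _ _
    rw [integral_div] at h1
    have h2 := hQx.trans_le h1
    exact (div_pos_iff_of_pos_right (by positivity)).1 h2
  filter_upwards [t2.eventually_const_le (half_lt_self hpos),
    tV.eventually_const_le (half_lt_self hpos), eventually_ge_atTop 0] with L hL2 hLV hL0
  have hmB := measurableSet_abs_le L
  have hsplit := integral_add_compl hmB hi
  rw [← mu2] at hsplit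
  have hle : mu2 μ L ≤ ∫ y, y ^ 2 ∂μ :=
    setIntegral_le_integral hi (Eventually.of_forall fun y => sq_nonneg y)
  have hG : L ^ 2 * Gbar μ L ≤ ∫ y in {y : ℝ | |y| ≤ L}ᶜ, y ^ 2 ∂μ := by
    have e : L ^ 2 * Gbar μ L = ∫ _y in {y : ℝ | |y| ≤ L}ᶜ, L ^ 2 ∂μ := by
      rw [compl_setOf_abs_le]; simp [Gbar, Measure.real, mul_comm]
    rw [e]
    refine setIntegral_mono_on (integrable_const _) hi.integrableOn hmB.compl fun y hy => ?_
    rw [compl_setOf_abs_le] at hy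
    exact sq_le_sq.2 (by rw [abs_of_nonneg hL0]; exact le_of_lt hy)
  constructor <;> linarith

theorem tendsto_mu2_atTop (μ : Measure ℝ) [IsFiniteMeasure μ]
    (hi : ¬ Integrable (fun y : ℝ => y ^ 2) μ) : Tendsto (mu2 μ) atTop atTop := by
  refine tendsto_atTop_atTop_of_monotone (fun x z hxz => ?_) fun b => ?_
  · exact setIntegral_mono_set (integrableOn_sq_abs_le μ z)
      (Eventually.of_forall fun y => sq_nonneg y)
      (Eventually.of_forall fun y (hy : |y| ≤ x) => hy.trans hxz)
  · by_contra! hb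
    exact hi ((aecover_abs_le μ).integrable_of_integral_bounded_of_nonneg_ae b
      (integrableOn_sq_abs_le μ) (Eventually.of_forall fun y => sq_nonneg y)
      (Eventually.of_forall fun L => (hb L).le))

theorem eventually_mu2_le_two_mul_truncVar (μ : Measure ℝ) [IsProbabilityMeasure μ]
    (hi : ¬ Integrable (fun y : ℝ => y ^ 2) μ) :
    ∀ᶠ L in atTop, mu2 μ L ≤ 2 * truncVar μ L := by
  obtain ⟨A, hA, hA0⟩ := (((tendsto_measureReal_abs_le μ).eventually_const_le
    (show (15 / 16 : ℝ) < 1 by norm_num)).and (eventually_gt_atTop 0)).exists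
  have hmA := (measurableSet_abs_le A).compl
  have hAc : μ.real {y : ℝ | |y| ≤ A}ᶜ ≤ 1 / 16 := by
    rw [probReal_compl_eq_one_sub (measurableSet_abs_le A)]; linarith
  filter_upwards [(tendsto_mu2_atTop μ hi).eventually_ge_atTop ((4 * A) ^ 2),
    (tendsto_measureReal_abs_le μ).eventually_const_le
    (show (15 / 16 : ℝ) < 1 by norm_num)] with L hL2 hLM
  set s := √(mu2 μ L)
  have hm2 : 0 ≤ mu2 μ L := (by positivity : (0 : ℝ) ≤ (4 * A) ^ 2).trans hL2
  have hs2 : s ^ 2 = mu2 μ L := Real.sq_sqrt hm2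
  have hsA : 4 * A ≤ s := Real.le_sqrt_of_sq_le hL2
  have hs0 : 0 < s := by linarith
  have hiL := integrableOn_sq_abs_le μ L
  have hind : Integrable ({y : ℝ | |y| ≤ A}ᶜ.indicator fun _ => 2 * s) μ :=
    (integrable_const _).indicator hmA
  have hpt (y : ℝ) : |y| ≤ A + y ^ 2 / (8 * s) + {y : ℝ | |y| ≤ A}ᶜ.indicator (fun _ => 2 * s) y := by
    by_cases hy : |y| ≤ A
    · have h2 : 0 ≤ {y : ℝ | |y| ≤ A}ᶜ.indicator (fun _ => 2 * s) y :=
        Set.indicator_nonneg (fun _ _ => by positivity) y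
      have : 0 ≤ y ^ 2 / (8 * s) := by positivity
      linarith
    · rw [Set.indicator_of_mem (show y ∈ {y : ℝ | |y| ≤ A}ᶜ from hy)]
      have : |y| ≤ y ^ 2 / (8 * s) + 2 * s := by
        rw [← sub_nonneg]
        have : y ^ 2 / (8 * s) + 2 * s - |y| = (|y| - 4 * s) ^ 2 / (8 * s) := by
          field_simp
          rw [sub_sq, sq_abs]
          ring
        rw [this]; positivity
      linarith
  have hmu1 : |mu1 μ L| ≤ s / 2 := by
    have hiA : IntegrableOn (fun y : ℝ => A + y ^ 2 / (8 * s)) {y : ℝ | |y| ≤ L} μ :=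
      (integrable_const _).add (hiL.div_const _)
    have hindle : ∫ y in {y : ℝ | |y| ≤ L}, {y : ℝ | |y| ≤ A}ᶜ.indicator (fun _ => 2 * s) y ∂μ ≤
        s / 8 := by
      calc _ ≤ ∫ y, {y : ℝ | |y| ≤ A}ᶜ.indicator (fun _ => 2 * s) y ∂μ :=
            setIntegral_le_integral hind (Eventually.of_forall fun y =>
              Set.indicator_nonneg (fun _ _ => by positivity) y)
        _ = μ.real {y : ℝ | |y| ≤ A}ᶜ * (2 * s) := by rw [integral_indicator hmA]; simp
        _ ≤ 1 / 16 * (2 * s) := by gcongr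
        _ = s / 8 := by ring
    have hmain : ∫ y in {y : ℝ | |y| ≤ L}, (A + y ^ 2 / (8 * s)) ∂μ ≤ A + s / 8 := by
      rw [integral_add (integrable_const _) (hiL.div_const _), integral_div, ← mu2, ← hs2]
      have h1 : ∫ _y in {y : ℝ | |y| ≤ L}, A ∂μ ≤ A := by
        rw [setIntegral_const, smul_eq_mul]
        exact mul_le_of_le_one_left hA0.le measureReal_le_one
      have h2 : s ^ 2 / (8 * s) = s / 8 := by field_simp
      linarith
    calc |mu1 μ L| ≤ ∫ y in {y : ℝ | |y| ≤ L}, |y| ∂μ := abs_integral_le_integral_abs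
      _ ≤ ∫ y in {y : ℝ | |y| ≤ L},
          (A + y ^ 2 / (8 * s) + {y : ℝ | |y| ≤ A}ᶜ.indicator (fun _ => 2 * s) y) ∂μ :=
        integral_mono_of_nonneg (Eventually.of_forall fun y => abs_nonneg y)
          (Integrable.add hiA hind.integrableOn) (Eventually.of_forall hpt)
      _ = _ := integral_add hiA hind.integrableOn
      _ ≤ A + s / 8 + s / 8 := add_le_add hmain hindle
      _ ≤ s / 2 := by linarith
  have hmu1sq : mu1 μ L ^ 2 ≤ mu2 μ L / 4 := by
    rw [← sq_abs, ← hs2]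
    calc |mu1 μ L| ^ 2 ≤ (s / 2) ^ 2 := pow_le_pow_left₀ (abs_nonneg _) hmu1 2
      _ = s ^ 2 / 4 := by ring
  rw [truncVar]
  nlinarith

theorem exists_moment_bounds (μ : Measure ℝ) [IsProbabilityMeasure μ]
    (hcase : (Integrable (fun y : ℝ => y ^ 2) μ ∧ ∫ y, y ∂μ = 0) ∨
      (¬ Integrable (fun y : ℝ => y ^ 2) μ ∧
        ∃ C : ℝ, ∀ᶠ x in atTop, x ^ 2 * Gbar μ x ≤ C * mu2 μ x))
    (hQ : ∃ x > 0, 0 < Qfun μ x) :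
    ∃ C > 0, ∀ᶠ L in atTop, mu2 μ L ≤ 2 * truncVar μ L ∧ L ^ 2 * Gbar μ L ≤ C * mu2 μ L := by
  rcases hcase with ⟨hi, h0⟩ | ⟨hi, C, hC⟩
  · refine ⟨1, one_pos, ?_⟩
    simpa using eventually_moment_bounds_of_integrable_sq μ hi h0 hQ
  · refine ⟨max C 1, by positivity, ?_⟩
    filter_upwards [eventually_mu2_le_two_mul_truncVar μ hi, hC] with L h1 h2
    refine ⟨h1, h2.trans ?_⟩
    have : 0 ≤ mu2 μ L := integral_nonneg fun y => sq_nonneg y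
    gcongr
    exact le_max_left _ _

theorem exists_exp_neg_mul_pow_le {b r : ℝ} (hb : 0 < b) (hr : 1 < r) :
    ∃ M > 0, ∀ k : ℕ, Real.exp (-(b * r ^ k)) ≤ M / 4 ^ k := by
  obtain ⟨m, hm⟩ := pow_unbounded_of_one_lt 4 hr
  have hr0 : 0 < r := one_pos.trans hr
  refine ⟨m.factorial / b ^ m, by positivity, fun k => ?_⟩
  have h1 := Real.pow_div_factorial_le_exp (b * r ^ k) (by positivity) m
  have h2 : b ^ m * 4 ^ k / m.factorial ≤ Real.exp (b * r ^ k) := by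
    refine le_trans ?_ h1
    rw [mul_pow, ← pow_mul, mul_comm k m, pow_mul]
    gcongr
  rw [Real.exp_neg, div_div]
  refine (inv_anti₀ (by positivity) h2).trans (le_of_eq ?_)
  rw [inv_div]

theorem exists_pow_norm_charFun_tiltMeasure_le (μ : Measure ℝ) [IsProbabilityMeasure μ]
    {x₀ C : ℝ} (hx₀ : 0 < x₀) (hC : 0 < C)
    (hmom : ∀ L ≥ x₀, mu2 μ L ≤ 2 * truncVar μ L ∧ L ^ 2 * Gbar μ L ≤ C * mu2 μ L) :
    ∃ K > 0, ∀ {h a t : ℝ} {n : ℕ} [IsProbabilityMeasure (tiltMeasure μ h)], 0 < |t| →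
      |t| ≤ 1 / x₀ → 1 / |t| ≤ h → 1 ≤ n → 0 < a → Qfun μ a = 1 / (n : ℝ) →
      ‖charFun (tiltMeasure μ h) t‖ ^ n ≤ K * (1 + (a * t) ^ 2)⁻¹ := by
  set c : ℝ := 4 / Real.pi ^ 2 * Real.exp (-2) ^ 2
  have hc : 0 < c := by positivity
  set b : ℝ := c / (4 * (1 + C))
  have hb : 0 < b := by positivity
  set r : ℝ := (4 + 4 * C) / (1 + 4 * C)
  have hr : 1 < r := (one_lt_div (by positivity)).2 (by linarith)
  obtain ⟨M, hM, hexp⟩ := exists_exp_neg_mul_pow_le hb hr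
  refine ⟨8 * M + 2, by positivity, fun {h a t n} _ ht0 ht hth hn ha hQ => ?_⟩
  rw [← div_eq_mul_inv, le_div_iff₀ (by positivity)]
  have hone : ‖charFun (tiltMeasure μ h) t‖ ^ n ≤ 1 :=
    pow_le_one₀ (norm_nonneg _) (norm_charFun_le_one _)
  have hnn : 0 ≤ ‖charFun (tiltMeasure μ h) t‖ ^ n := by positivity
  set L := 1 / |t| with hLdef
  have hL0 : 0 < L := by positivity
  have hLt : |t| = 1 / L := (one_div_one_div _).symm
  have hLx : x₀ ≤ L := (le_one_div hx₀ ht0).2 ht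
  have has : (a * t) ^ 2 = (a / L) ^ 2 := by
    rw [mul_pow, ← sq_abs t, hLt, div_pow, div_pow]; ring
  rw [has]
  set s := a / L
  have hs0 : 0 < s := by positivity
  rcases le_or_gt 1 s with hs | hs
  swap
  · have hs2 : s ^ 2 ≤ 1 := pow_le_one₀ hs0.le hs.le
    nlinarith
  obtain ⟨k, hk1, hk2⟩ := exists_nat_pow_near hs one_lt_two
  obtain ⟨hV, hG⟩ := hmom L hLx
  have hak : L ≤ a / 2 ^ k := by
    rw [le_div_iff₀ (by positivity), mul_comm]
    exact (le_div_iff₀ hL0).1 hk1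
  have hn0 : (0 : ℝ) < n := by exact_mod_cast hn
  have hQL : r ^ k ≤ n * Qfun μ L := by
    have h1 := mul_pow_Qfun_le μ hx₀ hC (fun x hx => (hmom x hx).2) k (a / 2 ^ k) (hLx.trans hak)
    rw [mul_div_cancel₀ a (by positivity), hQ] at h1
    have h2 := h1.trans (Qfun_le_Qfun μ hL0 hak)
    rw [mul_one_div, div_le_iff₀ hn0] at h2
    linarith
  have hQV : 4 * b * Qfun μ L ≤ c * (2 * truncVar μ L / L ^ 2) := by
    have h1 : Qfun μ L ≤ (1 + C) * (2 * truncVar μ L / L ^ 2) := by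
      rw [Qfun, ← mul_div_assoc]
      calc mu2 μ L / L ^ 2 + Gbar μ L = (mu2 μ L + L ^ 2 * Gbar μ L) / L ^ 2 := by
            field_simp
        _ ≤ (1 + C) * (2 * truncVar μ L) / L ^ 2 := by
            gcongr
            nlinarith
    calc 4 * b * Qfun μ L ≤ 4 * b * ((1 + C) * (2 * truncVar μ L / L ^ 2)) := by gcongr
      _ = c * (2 * truncVar μ L / L ^ 2) := by
        simp only [b]; field_simp
  have hφ : ‖charFun (tiltMeasure μ h) t‖ ^ 2 ≤ Real.exp (-(b * Qfun μ L)) ^ 2 := by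
    have h1 := sq_norm_charFun_tiltMeasure_le μ hL0 hth hLt
    have h2 : c * (2 * truncVar μ L / L ^ 2) = 2 * (c * (truncVar μ L / L ^ 2)) := by ring
    have h3 := Real.one_sub_le_exp_neg (2 * (b * Qfun μ L))
    rw [← Real.exp_nat_mul]
    calc _ ≤ 1 - c * (truncVar μ L / L ^ 2) := h1
      _ ≤ 1 - 2 * (b * Qfun μ L) := by linarith
      _ ≤ _ := h3
      _ = _ := by congr 1; push_cast; ring
  have hφ' : ‖charFun (tiltMeasure μ h) t‖ ≤ Real.exp (-(b * Qfun μ L)) :=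
    (pow_le_pow_iff_left₀ (norm_nonneg _) (Real.exp_pos _).le two_ne_zero).1 hφ
  have hφn : ‖charFun (tiltMeasure μ h) t‖ ^ n ≤ M / 4 ^ k := by
    calc _ ≤ Real.exp (-(b * Qfun μ L)) ^ n := pow_le_pow_left₀ (norm_nonneg _) hφ' n
      _ = Real.exp (-(b * (n * Qfun μ L))) := by rw [← Real.exp_nat_mul]; congr 1; ring
      _ ≤ Real.exp (-(b * r ^ k)) := by gcongr
      _ ≤ M / 4 ^ k := hexp k
  have hs4 : s ^ 2 ≤ 4 * 4 ^ k := by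
    calc s ^ 2 ≤ (2 ^ (k + 1)) ^ 2 := pow_le_pow_left₀ hs0.le hk2.le 2
      _ = 4 * 4 ^ k := by rw [← pow_mul, mul_comm, pow_mul]; norm_num; ring
  have hs1 : 1 ≤ s ^ 2 := one_le_pow₀ hs
  calc ‖charFun (tiltMeasure μ h) t‖ ^ n * (1 + s ^ 2)
      ≤ M / 4 ^ k * (2 * (4 * 4 ^ k)) := by gcongr; linarith
    _ = 8 * M := by field_simp; norm_num
    _ ≤ 8 * M + 2 := by linarith

theorem integral_indicator_add_inv_one_add_sq (h K : ℝ) {a : ℝ} (hh : 0 < h) (ha : 0 < a) :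
    Integrable (fun t : ℝ => (Icc (-(1 / h)) (1 / h)).indicator (fun _ => (1 : ℝ)) t +
      K * (1 + (a * t) ^ 2)⁻¹) ∧
    ∫ t : ℝ, ((Icc (-(1 / h)) (1 / h)).indicator (fun _ => (1 : ℝ)) t +
      K * (1 + (a * t) ^ 2)⁻¹) = 2 / h + K * Real.pi / a := by
  have h1 : Integrable ((Icc (-(1 / h)) (1 / h)).indicator (fun _ => (1 : ℝ))) :=
    (integrable_indicator_iff measurableSet_Icc).2 (integrableOn_const (by simp))
  have h2 : Integrable fun t : ℝ => (1 + (a * t) ^ 2)⁻¹ :=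
    integrable_inv_one_add_sq.comp_mul_left' ha.ne'
  refine ⟨h1.add (h2.const_mul K), ?_⟩
  rw [integral_add h1 (h2.const_mul K), integral_const_mul, integral_indicator measurableSet_Icc,
    Measure.integral_comp_mul_left (fun t : ℝ => (1 + t ^ 2)⁻¹) a, integral_univ_inv_one_add_sq]
  have h3 : (0 : ℝ) ≤ 1 / h - -(1 / h) := by
    have : 0 < 1 / h := by positivity
    linarith
  rw [setIntegral_const, Real.volume_real_Icc, max_eq_left h3, abs_of_pos (inv_pos.2 ha)]
  simp only [smul_eq_mul]
  ring

/-- Proposition 7.1: concentration bound for the tilted random walk `S_n^{(n)}`. -/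
theorem tilted_concentration
    (μ : Measure ℝ) [IsProbabilityMeasure μ]
    (T : ℝ) (hT : 0 < T)
    (hcase : (Integrable (fun y : ℝ => y ^ 2) μ ∧ ∫ y, y ∂μ = 0) ∨
      (¬ Integrable (fun y : ℝ => y ^ 2) μ ∧
        ∃ C : ℝ, ∀ᶠ x in atTop, x ^ 2 * Gbar μ x ≤ C * mu2 μ x))
    (h : ℕ → ℝ) (hh : Tendsto h atTop atTop)
    (a : ℕ → ℝ) (hapos : ∀ n, 0 < a n)
    (ha : ∀ᶠ n in atTop, Qfun μ (a n) = 1 / (n : ℝ)) :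
    ∃ C C' : ℝ, ∃ N : ℕ, ∀ n ≥ N, ∀ x : ℝ,
      (tiltWalkLaw μ (h n) n (Set.Ioc x (x + T))).toReal ≤ C / h n + C' / a n := by
  have hQ : ∃ x > 0, 0 < Qfun μ x := by
    obtain ⟨n, hn, hn1⟩ := (ha.and (eventually_ge_atTop 1)).exists
    exact ⟨a n, hapos n, by rw [hn]; positivity⟩
  obtain ⟨C, hC, hev⟩ := exists_moment_bounds μ hcase hQ
  obtain ⟨X, hX⟩ := eventually_atTop.1 hev
  set x₀ := max X T
  have hx₀ : 0 < x₀ := hT.trans_le (le_max_right _ _)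
  obtain ⟨K, hK, hdecay⟩ := exists_pow_norm_charFun_tiltMeasure_le μ hx₀ hC
    fun L hL => hX L ((le_max_left _ _).trans hL)
  have hcos : 0 < Real.cos 1 := Real.cos_one_pos
  have hD : 0 < 1 / x₀ * Real.cos 1 ^ 2 := by positivity
  have hmass : ∀ᶠ n in atTop, 0 < μ.real {y : ℝ | |y| ≤ h n} :=
    ((tendsto_measureReal_abs_le μ).comp hh).eventually_const_lt one_pos
  obtain ⟨N, hN⟩ := eventually_atTop.1
    ((ha.and (eventually_ge_atTop 1)).and ((hh.eventually_gt_atTop 0).and hmass))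
  refine ⟨2 / (1 / x₀ * Real.cos 1 ^ 2), K * Real.pi / (1 / x₀ * Real.cos 1 ^ 2), N,
    fun n hn x => ?_⟩
  obtain ⟨⟨hQn, hn1⟩, hhn, hmn⟩ := hN n hn
  have hIic : μ (Set.Iic (h n)) ≠ 0 := by
    refine ne_of_gt (lt_of_lt_of_le ?_
      (measure_mono fun y (hy : |y| ≤ h n) => (le_abs_self y).trans hy))
    exact (ENNReal.toReal_pos_iff.1 hmn).1
  have := isProbabilityMeasure_tiltMeasure μ hhn hIic
  have hprob : IsProbabilityMeasure (tiltWalkLaw μ (h n) n) :=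
    Measure.isProbabilityMeasure_map (by fun_prop)
  obtain ⟨hgi, hge⟩ := integral_indicator_add_inv_one_add_sq (h n) K hhn (hapos n)
  have hess := measureReal_closedBall_le_integral_of_norm_charFun_le (tiltWalkLaw μ (h n) n)
    (one_div_pos.2 hx₀) hgi (fun t => by
      have : 0 ≤ (Icc (-(1 / h n)) (1 / h n)).indicator (fun _ => (1 : ℝ)) t :=
        Set.indicator_nonneg (fun _ _ => zero_le_one) t
      positivity) (fun t ht => by
      rw [tiltWalkLaw, charFun_map_sum_pi_eq_prod]
      simp only [Finset.prod_const, Finset.card_univ, Fintype.card_fin, Pi.pow_apply, norm_pow]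
      by_cases hth : |t| ≤ 1 / h n
      · rw [Set.indicator_of_mem (show t ∈ Icc _ _ from abs_le.1 hth)]
        have h1 : ‖charFun (tiltMeasure μ (h n)) t‖ ^ n ≤ 1 :=
          pow_le_one₀ (norm_nonneg _) (norm_charFun_le_one _)
        have h2 : 0 ≤ K * (1 + (a n * t) ^ 2)⁻¹ := by positivity
        linarith
      · have h2 : 0 ≤ (Icc (-(1 / h n)) (1 / h n)).indicator (fun _ => (1 : ℝ)) t :=
          Set.indicator_nonneg (fun _ _ => zero_le_one) t
        have ht0 : 0 < |t| := (one_div_pos.2 hhn).trans (not_le.1 hth)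
        have h3 := hdecay ht0 ht ((one_div_le ht0 hhn).2 (not_le.1 hth).le) hn1 (hapos n) hQn
        linarith) x
  rw [one_div_one_div, hge] at hess
  calc (tiltWalkLaw μ (h n) n (Set.Ioc x (x + T))).toReal
      ≤ (tiltWalkLaw μ (h n) n).real (Metric.closedBall x x₀) := by
        refine measureReal_mono fun s hs => ?_
        rw [Real.closedBall_eq_Icc]
        have : T ≤ x₀ := le_max_right _ _
        exact ⟨by linarith [hs.1], by linarith [hs.2]⟩
    _ ≤ (2 / h n + K * Real.pi / a n) / (1 / x₀ * Real.cos 1 ^ 2) := (le_div_iff₀ hD).2 hess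
    _ = _ := by ring
end
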